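/- Let (X, d) be a nonempty compact metric space with diameter D_X > 0, let η ∈ (0, D_X], let y₁, …, y_J (J ≥ 2) be distinct points of X whose closed balls of radius η cover X, let q ∈ (1, √(1 + 1/(J−1))), and let (xₙ) be a dense sequence in X together with β : ℕ → {1, …, J} such that d(xₙ, y_{β(n)}) = min_j d(xₙ, yⱼ) for all n and ∑_{n ∈ β⁻¹({j})} q^{−2n} = (1/J)·q²/(q²−1) for each j. Define φ(x) = ((√(q²−1)/q)·d(x, xₙ)/qⁿ)ₙ ∈ ℓ², φ̂(x) = (d(x, yⱼ)/√J)ⱼ ∈ ℝ^J, and B(u) = ((√(J(q²−1))/q)·u_{β(n)}/qⁿ)ₙ ∈ ℓ². Let (aₙ) be positive reals such that K(t) = ∑ₙ aₙ tⁿ converges absolutely for |t| ≤ 4·D_X², and let C = max_{t ∈ [−4D_X², 4D_X²]} |K'(t)|. Then for every m ∈ ℕ, all z₁, …, z_m ∈ X and all reals a₁, …, a_m: sup_{x ∈ X} |∑_{i=1}^m aᵢ (K(⟨φ(zᵢ), φ(x)⟩_{ℓ²}) − K(⟨φ(zᵢ), B(φ̂(x))⟩_{ℓ²}))| ≤ √(2·D_X·C)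 · √η · √(∑_{i,j} aᵢ aⱼ K(⟨φ(zᵢ), φ(zⱼ)⟩_{ℓ²})). -/

import Mathlib

open Matrix in
/-- Entrywise powers of a Gram matrix are positive semidefinite. -/
theorem posSemidef_gram_map_pow {E ι : Type*} [NormedAddCommGroup E] [InnerProductSpace ℝ E]
    [Fintype ι] (w : ι → E) (n : ℕ) :
    ((gram ℝ w).map (· ^ n)).PosSemidef := by
  induction n with
  | zero =>
    have h : (gram ℝ w).map (· ^ 0) = gram ℝ fun _ : ι => (1 : ℝ) := by
      ext i j
      simp [gram_apply]
    exact h ▸ posSemidef_gram ℝ _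
  | succ n ih =>
    have h : (gram ℝ w).map (· ^ (n + 1)) = (gram ℝ w).map (· ^ n) ⊙ gram ℝ w := by
      ext i j
      simp [pow_succ]
    exact h ▸ ih.hadamard (posSemidef_gram ℝ w)

/-- A power series with nonnegative coefficients, applied to inner products at which it
converges, is a positive semidefinite kernel. -/
theorem sum_sum_mul_tsum_inner_pow_nonneg {E ι : Type*} [NormedAddCommGroup E]
    [InnerProductSpace ℝ E] [Fintype ι] (w : ι → E) (c : ι → ℝ) {a : ℕ → ℝ}
    (ha : ∀ n, 0 ≤ a n) (hs : ∀ i j, Summable fun n => a n * inner ℝ (w i) (w j) ^ n) :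
    0 ≤ ∑ i, ∑ j, c i * c j * ∑' n, a n * inner ℝ (w i) (w j) ^ n := by
  have h : HasSum (fun n => ∑ i, ∑ j, c i * c j * (a n * inner ℝ (w i) (w j) ^ n))
      (∑ i, ∑ j, c i * c j * ∑' n, a n * inner ℝ (w i) (w j) ^ n) :=
    hasSum_sum fun i _ => hasSum_sum fun j _ => (hs i j).hasSum.mul_left _
  refine h.nonneg fun n => ?_
  have hn := mul_nonneg (ha n) ((posSemidef_gram_map_pow w n).dotProduct_mulVec_nonneg c)
  convert hn using 1
  simp only [dotProduct, Matrix.mulVec, Matrix.map_apply, Matrix.gram_apply, Pi.star_apply,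
    star_trivial, Finset.mul_sum]
  exact Finset.sum_congr rfl fun i _ => Finset.sum_congr rfl fun j _ => by ring

/-- Cauchy–Schwarz inequality for a symmetric kernel that is positive semidefinite on the
points `w i`, `u`, `v`. -/
theorem abs_sum_kernel_sub_le_sqrt_mul_sqrt {E ι : Type*} [Fintype ι] (k : E → E → ℝ)
    (hsymm : ∀ p r, k p r = k r p) (w : ι → E) (u v : E) (c : ι → ℝ)
    (hpos : ∀ b : Option (Option ι) → ℝ,
      0 ≤ ∑ i, ∑ j, b i * b j *
        k (i.elim u (Option.elim · v w)) (j.elim u (Option.elim · v w))) :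
    |∑ i, c i * (k (w i) u - k (w i) v)| ≤
      √(k u u - 2 * k u v + k v v) * √(∑ i, ∑ j, c i * c j * k (w i) (w j)) := by
  set S := ∑ i, ∑ j, c i * c j * k (w i) (w j)
  set T := ∑ i, c i * (k (w i) u - k (w i) v) with hT
  set R := k u u - 2 * k u v + k v v
  have hquad (t : ℝ) : 0 ≤ S * (t * t) + (2 * T) * t + R := by
    have h := hpos fun i => i.elim 1 (Option.elim · (-1) fun j => t * c j)
    simp only [Fintype.sum_option, Option.elim] at h
    have h1 : ∑ i, ∑ j, t * c i * (t * c j) * k (w i) (w j) = S * (t * t) := by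
      simp only [S, Finset.sum_mul]
      exact Finset.sum_congr rfl fun i _ => Finset.sum_congr rfl fun j _ => by ring
    have h2 : T = ∑ i, c i * k (w i) u - ∑ i, c i * k (w i) v := by
      simp only [hT, mul_sub, Finset.sum_sub_distrib]
    have h3 (p : E) : ∑ i, 1 * (t * c i) * k p (w i) = t * ∑ i, c i * k (w i) p := by
      rw [Finset.mul_sum]
      exact Finset.sum_congr rfl fun i _ => by rw [hsymm p]; ring
    have h4 (p : E) : ∑ i, -1 * (t * c i) * k p (w i) = -(t * ∑ i, c i * k (w i) p) := by
      rw [Finset.mul_sum, ← Finset.sum_neg_distrib]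
      exact Finset.sum_congr rfl fun i _ => by rw [hsymm p]; ring
    have h5 : ∑ i, t * c i * 1 * k (w i) u = t * ∑ i, c i * k (w i) u := by
      rw [Finset.mul_sum]
      exact Finset.sum_congr rfl fun i _ => by ring
    have h6 : ∑ i, t * c i * -1 * k (w i) v = -(t * ∑ i, c i * k (w i) v) := by
      rw [Finset.mul_sum, ← Finset.sum_neg_distrib]
      exact Finset.sum_congr rfl fun i _ => by ring
    simp only [Finset.sum_add_distrib, h1, h3, h4, h5, h6, hsymm v u] at h
    rw [h2]
    linarith
  have hR : 0 ≤ R := by simpa using hquad 0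
  have hd := discrim_le_zero hquad
  rw [discrim] at hd
  rw [← Real.sqrt_mul hR]
  exact Real.abs_le_sqrt (by linarith)

/-- A real power series that converges absolutely at `r` is differentiable on `(-r, r)`. -/
theorem differentiableAt_tsum_mul_pow {a : ℕ → ℝ} {r t : ℝ}
    (hs : Summable fun n => |a n * r ^ n|) (ht : |t| < r) :
    DifferentiableAt ℝ (fun t => ∑' n, a n * t ^ n) t := by
  have hr : 0 < r := (abs_nonneg t).trans_lt ht
  lift r to NNReal using hr.le
  set p := FormalMultilinearSeries.ofScalars ℝ a
  have hrad : (r : ENNReal) ≤ p.radius := by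
    refine p.le_radius_of_summable_norm ?_
    refine hs.congr fun n => ?_
    rw [abs_mul, abs_of_pos (pow_pos hr n)]
    simp [p]
  have hpos : 0 < p.radius := lt_of_lt_of_le (by simpa using hr) hrad
  have hsum : p.sum = fun t => ∑' n, a n * t ^ n := by
    exact FormalMultilinearSeries.ofScalarsSum_eq_tsum (E := ℝ) (c := a)
  rw [← hsum]
  refine ((p.hasFPowerSeriesOnBall hpos).analyticAt_of_mem ?_).differentiableAt
  refine Metric.mem_eball.mpr (lt_of_lt_of_le ?_ hrad)
  rw [edist_zero_right, enorm_eq_nnnorm]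
  exact_mod_cast ht

/-- Geometrically decaying entries give an explicit bound of the `ℓ²` norm. -/
theorem lp_two_norm_le_of_abs_le_geometric {f : lp (fun _ : ℕ => ℝ) 2} {q R : ℝ} (hq : 1 < q)
    (hR : 0 ≤ R) (hf : ∀ n, |f n| ≤ √(q ^ 2 - 1) / q * R / q ^ n) : ‖f‖ ≤ R := by
  have hq2 : 1 < q ^ 2 := by nlinarith
  have hgeom : HasSum (fun n => R ^ 2 * ((q ^ 2 - 1) / q ^ 2) * ((q ^ 2)⁻¹) ^ n) (R ^ 2) := by
    have h1 : q ^ 2 - 1 ≠ 0 := by linarith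
    have h2 : R ^ 2 * ((q ^ 2 - 1) / q ^ 2) * (1 - (q ^ 2)⁻¹)⁻¹ = R ^ 2 := by
      rw [show 1 - (q ^ 2)⁻¹ = (q ^ 2 - 1) / q ^ 2 by field_simp]
      field_simp
    have h3 := (hasSum_geometric_of_lt_one (by positivity)
      (inv_lt_one_of_one_lt₀ hq2)).mul_left (R ^ 2 * ((q ^ 2 - 1) / q ^ 2))
    rwa [h2] at h3
  refine lp.norm_le_of_forall_sum_le (by norm_num) hR fun s => ?_
  simp only [ENNReal.toReal_ofNat, Real.rpow_ofNat, Real.norm_eq_abs]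
  refine (Finset.sum_le_sum fun n _ => ?_).trans
    (sum_le_hasSum s (fun n _ => ?_) hgeom)
  · refine (pow_le_pow_left₀ (abs_nonneg _) (hf n) 2).trans_eq ?_
    rw [div_pow, mul_pow, div_pow, Real.sq_sqrt (by linarith), inv_pow, ← pow_mul, ← pow_mul,
      mul_comm n 2]
    field_simp
  · have : 0 ≤ q ^ 2 - 1 := by linarith
    positivity

/-- Approximation of the universal Taylor kernel `k(x,y) = K(⟨φ x, φ y⟩)` by
the tractable kernel `K(⟨φ x, B(φ̂ y)⟩)`: the uniform error over `x ∈ X` of any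
finite kernel expansion `∑ᵢ aᵢ k(zᵢ, ·)` is bounded by
`√(2·D_X·C) · √η · √(∑_{i,j} aᵢ aⱼ k(zᵢ, zⱼ))`. -/
theorem taylor_approx_universal
    {X : Type*} [MetricSpace X] [CompactSpace X] [Nonempty X]
    (hD : 0 < Metric.diam (Set.univ : Set X))
    (J : ℕ) (hJ : 2 ≤ J) (η : ℝ)
    (hη : η ∈ Set.Ioc (0 : ℝ) (Metric.diam (Set.univ : Set X)))
    (y : Fin J → X) (hy : Function.Injective y)
    (hcover : ∀ x : X, ∃ j, dist x (y j) ≤ η)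
    (q : ℝ) (hq1 : 1 < q) (hq2 : q < Real.sqrt (1 + 1 / ((J : ℝ) - 1)))
    (x_ : ℕ → X) (hdense : ∀ (x : X) (ε : ℝ), 0 < ε → ∃ n, dist x (x_ n) ≤ ε)
    (β : ℕ → Fin J)
    (hβmin : ∀ (n : ℕ) (j : Fin J), dist (x_ n) (y (β n)) ≤ dist (x_ n) (y j))
    (hβ : ∀ j, ∑' n : (β ⁻¹' {j} : Set ℕ), 1 / q ^ (2 * (n : ℕ)) =
      (1 / (J : ℝ)) * (q ^ 2 / (q ^ 2 - 1)))
    (φ : X → lp (fun _ : ℕ => ℝ) 2)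
    (hφ : ∀ (x : X) (n : ℕ),
      φ x n = Real.sqrt (q ^ 2 - 1) / q * dist x (x_ n) / q ^ n)
    (φhat : X → EuclideanSpace ℝ (Fin J))
    (hφhat : ∀ (x : X) (j : Fin J), φhat x j = dist x (y j) / Real.sqrt J)
    (B : EuclideanSpace ℝ (Fin J) → lp (fun _ : ℕ => ℝ) 2)
    (hB : ∀ (u : EuclideanSpace ℝ (Fin J)) (n : ℕ),
      B u n = Real.sqrt ((J : ℝ) * (q ^ 2 - 1)) / q * u (β n) / q ^ n)
    (a : ℕ → ℝ) (ha : ∀ n, 0 < a n)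
    (hconv : ∀ t : ℝ, |t| ≤ 4 * Metric.diam (Set.univ : Set X) ^ 2 →
      Summable fun n : ℕ => |a n * t ^ n|)
    (K : ℝ → ℝ) (hK : ∀ t : ℝ, K t = ∑' n : ℕ, a n * t ^ n)
    (C : ℝ)
    (hC : IsGreatest ((fun t => |deriv K t|) ''
      Set.Icc (-(4 * Metric.diam (Set.univ : Set X) ^ 2))
        (4 * Metric.diam (Set.univ : Set X) ^ 2)) C) :
    ∀ (m : ℕ) (z : Fin m → X) (c : Fin m → ℝ) (x : X),
      |∑ i, c i * (K (inner (𝕜 := ℝ) (φ (z i)) (φ x)) -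
          K (inner (𝕜 := ℝ) (φ (z i)) (B (φhat x))))| ≤
        Real.sqrt (2 * Metric.diam (Set.univ : Set X) * C) * Real.sqrt η *
          Real.sqrt (∑ i, ∑ j,
            c i * c j * K (inner (𝕜 := ℝ) (φ (z i)) (φ (z j)))) := by
  intro m z c x
  set D := Metric.diam (Set.univ : Set X)
  have hdist (p r : X) : dist p r ≤ D :=
    Metric.dist_le_diam_of_mem isCompact_univ.isBounded (Set.mem_univ _) (Set.mem_univ _)
  have hJ0 : (0 : ℝ) < J := by exact_mod_cast (by lia : 0 < J)
  have hq0 : 0 < q := by linarith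
  have hBφ (n : ℕ) :
      B (φhat x) n = √(q ^ 2 - 1) / q * dist x (y (β n)) / q ^ n := by
    rw [hB, hφhat, Real.sqrt_mul hJ0.le]
    field_simp
  have hφnorm (p : X) : ‖φ p‖ ≤ D := by
    refine lp_two_norm_le_of_abs_le_geometric hq1 hD.le fun n => ?_
    rw [hφ, abs_of_nonneg (by positivity)]
    gcongr
    exact hdist _ _
  have hBnorm : ‖B (φhat x)‖ ≤ D := by
    refine lp_two_norm_le_of_abs_le_geometric hq1 hD.le fun n => ?_
    rw [hBφ, abs_of_nonneg (by positivity)]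
    gcongr
    exact hdist _ _
  have hclose : ‖φ x - B (φhat x)‖ ≤ η := by
    refine lp_two_norm_le_of_abs_le_geometric hq1 hη.1.le fun n => ?_
    have hβη : dist (x_ n) (y (β n)) ≤ η := by
      obtain ⟨j, hj⟩ := hcover (x_ n)
      exact (hβmin n j).trans hj
    rw [lp.coeFn_sub, Pi.sub_apply, hφ, hBφ, ← sub_div, ← mul_sub, abs_div, abs_mul,
      abs_of_nonneg (by positivity : 0 ≤ √(q ^ 2 - 1) / q),
      abs_of_nonneg (by positivity : 0 ≤ q ^ n)]
    gcongr
    refine le_trans ?_ hβη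
    simpa only [dist_comm x] using abs_dist_sub_le (x_ n) (y (β n)) x
  have hKlip (s t : ℝ) (hs : |s| ≤ D ^ 2) (ht : |t| ≤ D ^ 2) : |K t - K s| ≤ C * |t - s| := by
    have hD2 : 0 < D ^ 2 := by positivity
    have hKeq : K = fun t => ∑' n, a n * t ^ n := funext hK
    refine Convex.norm_image_sub_le_of_norm_deriv_le (f := K) (s := Set.Icc (-(D ^ 2)) (D ^ 2))
      (fun r hr => ?_) (fun r hr => hC.2 ⟨r, ⟨?_, ?_⟩, rfl⟩) (convex_Icc _ _)
      (abs_le.mp hs) (abs_le.mp ht)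
    · rw [hKeq]
      refine differentiableAt_tsum_mul_pow (hconv (4 * D ^ 2) ?_) ?_
      · rw [abs_of_nonneg (by positivity)]
      · linarith [abs_le.mpr hr]
    · linarith [hr.1]
    · linarith [hr.2]
  have hinner {u v : lp (fun _ : ℕ => ℝ) 2} (hu : ‖u‖ ≤ D) (hv : ‖v‖ ≤ D) :
      |inner ℝ u v| ≤ D ^ 2 := by
    refine (abs_real_inner_le_norm u v).trans ?_
    rw [sq]
    gcongr
  have hC0 : 0 ≤ C := by
    obtain ⟨r, _, hr⟩ := hC.1
    exact hr ▸ abs_nonneg _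
  have hstep {u v w : lp (fun _ : ℕ => ℝ) 2} (hu : ‖u‖ ≤ D) (hv : ‖v‖ ≤ D) (hw : ‖w‖ ≤ D)
      (huv : ‖u - v‖ ≤ η) : K (inner ℝ w u) - K (inner ℝ w v) ≤ C * (D * η) := by
    refine (le_abs_self _).trans ((hKlip _ _ (hinner hw hv) (hinner hw hu)).trans ?_)
    rw [← inner_sub_right]
    gcongr
    exact (abs_real_inner_le_norm _ _).trans (by gcongr)
  have hCS := abs_sum_kernel_sub_le_sqrt_mul_sqrt (fun p r => K (inner ℝ p r))
    (fun p r => by rw [real_inner_comm]) (fun i => φ (z i)) (φ x) (B (φhat x)) c ?_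
  · refine hCS.trans ?_
    rw [← Real.sqrt_mul (mul_nonneg (mul_nonneg zero_le_two hD.le) hC0)]
    refine mul_le_mul_of_nonneg_right (Real.sqrt_le_sqrt ?_) (Real.sqrt_nonneg _)
    have h1 := hstep (hφnorm x) hBnorm (hφnorm x) hclose
    have h2 := hstep hBnorm (hφnorm x) hBnorm (by rwa [norm_sub_rev])
    rw [real_inner_comm (φ x) (B (φhat x))] at h2
    linarith
  · intro b
    simp only [hK]
    refine sum_sum_mul_tsum_inner_pow_nonneg _ b (fun n => (ha n).le) fun i j => ?_
    have hw (i : Option (Option (Fin m))) :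
        ‖i.elim (φ x) (Option.elim · (B (φhat x)) fun i => φ (z i))‖ ≤ D := by
      rcases i with _ | _ | i
      exacts [hφnorm x, hBnorm, hφnorm _]
    refine (hconv _ ((hinner (hw i) (hw j)).trans ?_)).of_abs
    nlinarith
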